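/- If G: ℝ → ℝ is differentiable and for all smooth compactly supported vector fields a⁽¹⁾, a⁽²⁾ on ℝ³ and all smooth θ: ℝ³ → ℝ one has ∫_{ℝ³} ε^{ijk} a⁽¹⁾ᵢ a⁽²⁾ₖ (∂ⱼθ) G'(θ) d³x = 0, then G' ≡ 0, i.e. G is constant. -/

import Mathlib

open Real MeasureTheory

/-- The totally antisymmetric Levi-Civita symbol on three indices with ε₀₁₂ = 1. -/
noncomputable def levicivita (i j k : Fin 3) : ℝ :=
  (((i : ℝ) - (j : ℝ)) * ((j : ℝ) - (k : ℝ)) * ((k : ℝ) - (i : ℝ))) / 2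

theorem contDiff_prod_coord {n : ℕ} {f : Fin n → ℝ → ℝ}
    (hf : ∀ i, ContDiff ℝ (⊤ : ℕ∞) (f i)) :
    ContDiff ℝ (⊤ : ℕ∞) (fun x : Fin n → ℝ => ∏ i, f i (x i)) :=
  contDiff_prod fun i _ => (hf i).comp (contDiff_apply ℝ ℝ i)

theorem hasCompactSupport_prod_coord {n : ℕ} {f : Fin n → ℝ → ℝ}
    (hf : ∀ i, HasCompactSupport (f i)) :
    HasCompactSupport (fun x : Fin n → ℝ => ∏ i, f i (x i)) := by
  refine HasCompactSupport.intro (isCompact_univ_pi fun i => hf i) fun x hx => ?_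
  simp only [Set.mem_pi, Set.mem_univ, true_implies, not_forall] at hx
  obtain ⟨i, hi⟩ := hx
  exact Finset.prod_eq_zero (Finset.mem_univ i) (image_eq_zero_of_notMem_tsupport hi)

/-- Testing against `θ x = x 0` and product vector fields shows that `deriv G` annihilates every
one-dimensional test function. -/
theorem integral_mul_deriv_eq_zero {G : ℝ → ℝ}
    (h : ∀ a₁ a₂ : (Fin 3 → ℝ) → (Fin 3 → ℝ),
      ∀ θ : (Fin 3 → ℝ) → ℝ,
      ContDiff ℝ (⊤ : ℕ∞) a₁ → HasCompactSupport a₁ →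
      ContDiff ℝ (⊤ : ℕ∞) a₂ → HasCompactSupport a₂ →
      ContDiff ℝ (⊤ : ℕ∞) θ →
      (∫ x : Fin 3 → ℝ, ∑ i : Fin 3, ∑ j : Fin 3, ∑ k : Fin 3,
        levicivita i j k * a₁ x i * a₂ x k *
          (fderiv ℝ θ x (Pi.single j 1)) * deriv G (θ x)) = 0)
    {φ : ℝ → ℝ} (hφ : ContDiff ℝ (⊤ : ℕ∞) φ) (hφc : HasCompactSupport φ) :
    ∫ t, φ t * deriv G t = 0 := by
  obtain ⟨R, hR0, hR⟩ : ∃ R : ℝ, 0 < R ∧ tsupport φ ⊆ Metric.closedBall 0 R := by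
    obtain ⟨R, hR⟩ := hφc.isBounded.subset_closedBall 0
    exact ⟨max R 1, by positivity, hR.trans (Metric.closedBall_subset_closedBall (le_max_left _ _))⟩
  let b : ContDiffBump (0 : ℝ) := ⟨R, R + 1, hR0, by linarith⟩
  have hb : ∀ t, φ t * b t = φ t := fun t => by
    by_cases ht : t ∈ tsupport φ
    · rw [b.one_of_mem_closedBall (hR ht), mul_one]
    · rw [image_eq_zero_of_notMem_tsupport ht, zero_mul]
  let f : Fin 3 → ℝ → ℝ := ![φ, b, b]
  let g : Fin 3 → ℝ → ℝ := fun _ => b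
  have hbs : ContDiff ℝ (⊤ : ℕ∞) b := b.contDiff
  have hf : ∀ i, ContDiff ℝ (⊤ : ℕ∞) (f i) := by
    intro i; fin_cases i <;> assumption
  have hfc : ∀ i, HasCompactSupport (f i) := by
    intro i; fin_cases i
    exacts [hφc, b.hasCompactSupport, b.hasCompactSupport]
  have key := h (fun x => (∏ i, f i (x i)) • Pi.single 2 1)
    (fun x => (∏ i, g i (x i)) • Pi.single 1 1) (fun x => x 0)
    ((contDiff_prod_coord hf).smul contDiff_const) (hasCompactSupport_prod_coord hfc).smul_right
    ((contDiff_prod_coord fun _ => hbs).smul contDiff_const)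
    (hasCompactSupport_prod_coord fun _ => b.hasCompactSupport).smul_right
    (contDiff_apply ℝ ℝ 0)
  let F : Fin 3 → ℝ → ℝ := ![fun t => φ t * deriv G t, fun t => b t * b t, fun t => b t * b t]
  have hfd : ∀ x : Fin 3 → ℝ, fderiv ℝ (fun x : Fin 3 → ℝ => x 0) x
      = ContinuousLinearMap.proj 0 := fun x =>
    (ContinuousLinearMap.proj (R := ℝ) (φ := fun _ : Fin 3 => ℝ) 0).fderiv
  have hint : ∫ x : Fin 3 → ℝ, ∏ i, F i (x i) = 0 := by
    rw [← key]
    refine integral_congr_ae (.of_forall fun x => ?_)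
    simp only [hfd]
    simp [Fin.prod_univ_three, levicivita, F, f, g, Pi.single_apply]
    linear_combination (-(deriv G (x 0) * b (x 1) ^ 2 * b (x 2) ^ 2)) * hb (x 0)
  rw [integral_fintype_prod_volume_eq_prod, Fin.prod_univ_three] at hint
  have hpos : 0 < ∫ t, b t * b t := by
    refine (b.continuous.mul b.continuous).integral_pos_of_hasCompactSupport_nonneg_nonzero
      b.hasCompactSupport.mul_right (x := 0) (fun t => mul_self_nonneg _) ?_
    have : b 0 = 1 := b.one_of_mem_closedBall (Metric.mem_closedBall_self hR0.le)
    simp [this]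
  simpa [F, hpos.ne'] using hint

/-- A function with bounded derivative on a ball, whose derivative annihilates all test functions,
has zero derivative on that ball. -/
theorem deriv_eq_zero_of_bounded {G : ℝ → ℝ} (hG : Differentiable ℝ G)
    (h : ∀ φ : ℝ → ℝ, ContDiff ℝ (⊤ : ℕ∞) φ → HasCompactSupport φ → ∫ t, φ t * deriv G t = 0)
    {u r C : ℝ} (hC : ∀ t ∈ Metric.ball u r, |deriv G t| ≤ C) {v : ℝ} (hv : v ∈ Metric.ball u r) :
    deriv G v = 0 := by
  have hint : IntegrableOn (deriv G) (Metric.ball u r) :=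
    IntegrableOn.of_bound measure_ball_lt_top (measurable_deriv G).aestronglyMeasurable C
      ((ae_restrict_iff' Metric.isOpen_ball.measurableSet).2 (.of_forall hC))
  have hae := Metric.isOpen_ball.ae_eq_zero_of_integral_contDiff_smul_eq_zero
    hint.locallyIntegrableOn fun g hg hgc _ => h g hg hgc
  have hconst : ∀ w ∈ Metric.ball u r, G w = G v := by
    intro w hw
    have hsub : Set.uIcc v w ⊆ Metric.ball u r :=
      (convex_ball u r).ordConnected.uIcc_subset hv hw
    have hFTC := intervalIntegral.integral_eq_sub_of_hasDerivAt
      (fun t _ => (hG t).hasDerivAt) (hint.mono_set hsub).intervalIntegrable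
    have hzero : ∫ t in v..w, deriv G t = 0 :=
      intervalIntegral.integral_zero_ae (hae.mono fun t ht hmem =>
        ht (hsub (Set.uIoc_subset_uIcc hmem)))
    linarith
  have : G =ᶠ[nhds v] fun _ => G v := by
    filter_upwards [Metric.isOpen_ball.mem_nhds hv] with w hw using hconst w hw
  rw [this.deriv_eq, deriv_const]

/-- If a derivative vanishes on every ball where it is bounded, it vanishes identically. -/
theorem deriv_eq_zero_of_forall_bounded {G : ℝ → ℝ} (hG : Differentiable ℝ G)
    (h : ∀ u r C : ℝ, (∀ t ∈ Metric.ball u r, |deriv G t| ≤ C) →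
      ∀ v ∈ Metric.ball u r, deriv G v = 0) (u : ℝ) : deriv G u = 0 := by
  let U : Set ℝ := {u | ∃ r > 0, ∃ C, ∀ t ∈ Metric.ball u r, |deriv G t| ≤ C}
  have hU0 : ∀ v ∈ U, deriv G v = 0 := fun v ⟨r, hr, C, hC⟩ =>
    h v r C hC v (Metric.mem_ball_self hr)
  refine hU0 u ?_
  by_contra hu
  have hUo : IsOpen U := by
    refine Metric.isOpen_iff.2 fun v ⟨r, hr, C, hC⟩ => ⟨r, hr, fun w hw => ?_⟩
    obtain ⟨s, hs, hsub⟩ := Metric.isOpen_iff.1 Metric.isOpen_ball w hw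
    exact ⟨s, hs, C, fun t ht => hC t (hsub ht)⟩
  let A : ℕ → Set ℝ := fun n =>
    {x | ∀ y, 1 / ((n : ℝ) + 1) ≤ |y - x| ∨ |G y - G x| ≤ n * |y - x|}
  have hA : ∀ n, IsClosed (A n) := by
    intro n
    have hGc := hG.continuous
    simp only [A, Set.ofPred_forall, Set.ofPred_or]
    refine isClosed_iInter fun y => (isClosed_le ?_ ?_).union (isClosed_le ?_ ?_) <;> fun_prop
  have hcover : ∀ x, ∃ n, x ∈ A n := by
    intro x
    obtain ⟨K, hK⟩ := (hG x).isBigO_sub.bound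
    obtain ⟨ε, hε, hb⟩ := Metric.eventually_nhds_iff.1 hK
    obtain ⟨n₁, hn₁⟩ := exists_nat_ge K
    obtain ⟨n₂, hn₂⟩ := exists_nat_one_div_lt hε
    refine ⟨max n₁ n₂, fun y => or_iff_not_imp_left.2 fun hy => ?_⟩
    have h₁ : 1 / (((max n₁ n₂ : ℕ) : ℝ) + 1) ≤ 1 / ((n₂ : ℝ) + 1) := by
      gcongr; exact le_max_right _ _
    have h₂ : (n₁ : ℝ) ≤ ((max n₁ n₂ : ℕ) : ℝ) := by gcongr; exact le_max_left _ _
    have h₃ := hb (y := y) (by rw [Real.dist_eq]; linarith [not_le.1 hy])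
    simp only [Real.norm_eq_abs] at h₃
    exact h₃.trans (by gcongr; linarith)
  have hbound : ∀ n, ∀ x ∈ A n, |deriv G x| ≤ n := by
    intro n x hx
    refine (hG x).hasDerivAt.le_of_lip' (C := n) n.cast_nonneg ?_
    filter_upwards [Metric.ball_mem_nhds x (show 0 < 1 / ((n : ℝ) + 1) by positivity)] with y hy
    rw [Metric.mem_ball, Real.dist_eq] at hy
    exact (hx y).resolve_left hy.not_ge
  have : CompleteSpace (Uᶜ : Set ℝ) := hUo.isClosed_compl.completeSpace_coe
  have : Nonempty (Uᶜ : Set ℝ) := ⟨⟨u, hu⟩⟩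
  obtain ⟨n, ⟨x, hxU⟩, hx⟩ := nonempty_interior_of_iUnion_of_closed
    (f := fun n => ((↑) : (Uᶜ : Set ℝ) → ℝ) ⁻¹' A n)
    (fun n => (hA n).preimage continuous_subtype_val)
    (Set.eq_univ_of_forall fun x => Set.mem_iUnion.2 (hcover x))
  obtain ⟨ε, hε, hball⟩ := Metric.mem_nhds_iff.1 (mem_interior_iff_mem_nhds.1 hx)
  refine hxU ⟨ε, hε, n, fun t ht => ?_⟩
  by_cases htU : t ∈ U
  · simp [hU0 t htU]
  · exact hbound n t (hball (show (⟨t, htU⟩ : (Uᶜ : Set ℝ)) ∈ Metric.ball _ _ from ht))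

theorem G0_constant
    (G : ℝ → ℝ) (hG : Differentiable ℝ G)
    (h : ∀ a₁ a₂ : (Fin 3 → ℝ) → (Fin 3 → ℝ),
      ∀ θ : (Fin 3 → ℝ) → ℝ,
      ContDiff ℝ (⊤ : ℕ∞) a₁ → HasCompactSupport a₁ →
      ContDiff ℝ (⊤ : ℕ∞) a₂ → HasCompactSupport a₂ →
      ContDiff ℝ (⊤ : ℕ∞) θ →
      (∫ x : Fin 3 → ℝ, ∑ i : Fin 3, ∑ j : Fin 3, ∑ k : Fin 3,
        levicivita i j k * a₁ x i * a₂ x k *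
          (fderiv ℝ θ x (Pi.single j 1)) * deriv G (θ x)) = 0) :
    ∀ u : ℝ, deriv G u = 0 := by
  exact deriv_eq_zero_of_forall_bounded hG fun _ _ _ hC _ hv =>
    deriv_eq_zero_of_bounded hG (fun _ hφ hφc => integral_mul_deriv_eq_zero h hφ hφc) hC hv
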